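/- Let t ∈ ℕ and δ, μ, d > 0. There exists s ∈ ℕ such that the following holds: if 𝒜 is a (d,ee)-dense reduced hypergraph with index set I that does not support a K₅⁽³⁾, K, L, M ⊆ I are pairwise disjoint subsets each of size at least s, and 𝒬 (a (K,L)-transversal), ℛ (a (K,M)-transversal), 𝒮 (an (L,M)-transversal) form an inhabited triple, then there exist subsets K⋆ ⊆ K, L⋆ ⊆ L, M⋆ ⊆ M of size at least t such that (i) at most one of the three pairs of restricted transversals 𝒬(K⋆,L⋆)ℛ(K⋆,M⋆), 𝒬(K⋆,L⋆)𝒮(L⋆,M⋆), ℛ(K⋆,M⋆)𝒮(L⋆,M⋆) has δ-intersecting links, and every pair that does not have δ-intersecting links has δ-disjoint links; and (ii) for every k ∈ K⋆, ℓ ∈ L⋆, m ∈ M⋆ the links Λ(𝒬,K⋆,ℓ), Λ(𝒬,L⋆,k), Λ(ℛ,K⋆,m), Λ(ℛ,M⋆,k), Λ(𝒮,L⋆,m) and Λ(𝒮,M⋆,ℓ) are (μ,d)-holes. -/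

import Mathlib

open Finset Classical

noncomputable section

/-- A reduced hypergraph: a finite (linearly ordered, here `ℕ`) index set `I`,
pairwise disjoint nonempty finite vertex classes `P i j` for distinct `i j ∈ I`,
and for each triple of distinct indices a tripartite 3-uniform constituent,
encoded by a symmetric edge predicate on vertices. -/
structure ReducedHG where
  I : Finset ℕ
  P : ℕ → ℕ → Finset ℕ
  Psymm : ∀ i j, P i j = P j i
  Pnonempty : ∀ i j, i ∈ I → j ∈ I → i ≠ j → (P i j).Nonempty
  Pdisjoint : ∀ i j k l, i ≠ j → k ≠ l → ({i, j} : Finset ℕ) ≠ ({k, l} : Finset ℕ) →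
      Disjoint (P i j) (P k l)
  Edge : ℕ → ℕ → ℕ → Prop
  EdgeSymm : ∀ a b c, Edge a b c → Edge b a c
  EdgeSymm' : ∀ a b c, Edge a b c → Edge a c b
  EdgeValid : ∀ a b c, Edge a b c → ∃ i j k, i ∈ I ∧ j ∈ I ∧ k ∈ I ∧
      i ≠ j ∧ i ≠ k ∧ j ≠ k ∧ a ∈ P i j ∧ b ∈ P i k ∧ c ∈ P j k

namespace ReducedHG

variable (A : ReducedHG)

/-- The neighbourhood, inside the vertex class `P j k`, of two vertices `a`, `b`. -/
def nbhd (j k : ℕ) (a b : ℕ) : Finset ℕ := (A.P j k).filter fun c => A.Edge a b c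

/-- The number of crossing edges between three vertex sets. -/
def ecount (X Y Z : Finset ℕ) : ℕ :=
  ((X ×ˢ Y ×ˢ Z).filter fun t => A.Edge t.1 t.2.1 t.2.2).card

/-- `(d, ee)`-density: every pair of vertices sharing an index has large degree. -/
def EEDense (d : ℝ) : Prop :=
  ∀ i j k, i ∈ A.I → j ∈ A.I → k ∈ A.I → i ≠ j → i ≠ k → j ≠ k →
    ∀ a ∈ A.P i j, ∀ b ∈ A.P i k,
      d * ((A.P j k).card : ℝ) ≤ ((A.nbhd j k a b).card : ℝ)

/-- `(μ, vvv)`-density: every constituent has many edges. -/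
def VVVDense (μ : ℝ) : Prop :=
  ∀ i j k, i ∈ A.I → j ∈ A.I → k ∈ A.I → i ≠ j → i ≠ k → j ≠ k →
    μ * (((A.P i j).card : ℝ) * ((A.P i k).card : ℝ) * ((A.P j k).card : ℝ)) ≤
      (A.ecount (A.P i j) (A.P i k) (A.P j k) : ℝ)

/-- The reduced hypergraph supports a `K₅⁽³⁾`. -/
def SupportsK5 : Prop :=
  ∃ J ⊆ A.I, J.card = 5 ∧ ∃ f : ℕ → ℕ → ℕ,
    (∀ i ∈ J, ∀ j ∈ J, f i j = f j i) ∧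
    (∀ i ∈ J, ∀ j ∈ J, i ≠ j → f i j ∈ A.P i j) ∧
    (∀ i ∈ J, ∀ j ∈ J, ∀ k ∈ J, i ≠ j → i ≠ k → j ≠ k →
      A.Edge (f i j) (f i k) (f j k))

/-- `ε`-wicked: `(1/3 + ε, ee)`-dense and not supporting a `K₅⁽³⁾`. -/
def Wicked (ε : ℝ) : Prop := A.EEDense (1/3 + ε) ∧ ¬ A.SupportsK5

/-- A `J`-transversal: one vertex in each class `P i j`, `ij ∈ J⁽²⁾`. -/
def IsTransversal (J : Finset ℕ) (Q : ℕ → ℕ → ℕ) : Prop :=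
  (∀ i ∈ J, ∀ j ∈ J, Q i j = Q j i) ∧ ∀ i ∈ J, ∀ j ∈ J, i ≠ j → Q i j ∈ A.P i j

/-- A `(K, L)`-transversal: one vertex in each class `P k l`, `(k, l) ∈ K × L`. -/
def IsTransversal2 (K L : Finset ℕ) (Q : ℕ → ℕ → ℕ) : Prop :=
  ∀ k ∈ K, ∀ l ∈ L, Q k l ∈ A.P k l

/-- An inhabited triple of `J`-transversals. -/
def InhabitedTriple (J : Finset ℕ) (Q R S : ℕ → ℕ → ℕ) : Prop :=
  ∀ i ∈ J, ∀ j ∈ J, ∀ k ∈ J, i < j → j < k → A.Edge (Q i j) (R i k) (S j k)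

/-- An inhabited triple consisting of a `(K,L)`-, a `(K,M)`- and an `(L,M)`-transversal. -/
def InhabitedTriple2 (K L M : Finset ℕ) (Q R S : ℕ → ℕ → ℕ) : Prop :=
  ∀ k ∈ K, ∀ l ∈ L, ∀ m ∈ M, A.Edge (Q k l) (R k m) (S l m)

/-- `Φ` is a `μ`-hole on `J`. -/
def IsHole (μ : ℝ) (J : Finset ℕ) (Φ : Finset ℕ) : Prop :=
  (∀ i ∈ J, ∀ j ∈ J, i ≠ j → (Φ ∩ A.P i j).Nonempty) ∧
  ∀ i ∈ J, ∀ j ∈ J, ∀ k ∈ J, i ≠ j → i ≠ k → j ≠ k →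
    (A.ecount (Φ ∩ A.P i j) (Φ ∩ A.P i k) (Φ ∩ A.P j k) : ℝ) ≤
      μ * (((A.P i j).card : ℝ) * ((A.P i k).card : ℝ) * ((A.P j k).card : ℝ))

/-- `Φ` is a `(μ, ϑ)`-hole on `J` (a `μ`-hole of width at least `ϑ`). -/
def IsHoleW (μ ϑ : ℝ) (J : Finset ℕ) (Φ : Finset ℕ) : Prop :=
  A.IsHole μ J Φ ∧ ∀ i ∈ J, ∀ j ∈ J, i ≠ j →
    ϑ * ((A.P i j).card : ℝ) ≤ (((Φ ∩ A.P i j)).card : ℝ)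

/-- Two holes are `ε`-intersecting on `J`. -/
def HolesIntersecting (ε : ℝ) (J : Finset ℕ) (Φ Ψ : Finset ℕ) : Prop :=
  ∀ i ∈ J, ∀ j ∈ J, i ≠ j →
    ε * ((A.P i j).card : ℝ) ≤ ((Φ ∩ Ψ ∩ A.P i j).card : ℝ)

/-- Two holes are `ε`-disjoint on `J`. -/
def HolesDisjoint (ε : ℝ) (J : Finset ℕ) (Φ Ψ : Finset ℕ) : Prop :=
  ∀ i ∈ J, ∀ j ∈ J, i ≠ j →
    ((Φ ∩ Ψ ∩ A.P i j).card : ℝ) < ε * ((A.P i j).card : ℝ)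

/-- The link on `K` of the family `k ↦ f k`, where `f k` is a vertex in a class `P k ·`:
`⋃_{k ≠ k' ∈ K} N(f k, f k')`. -/
def link (K : Finset ℕ) (f : ℕ → ℕ) : Finset ℕ :=
  ((K ×ˢ K).filter fun p => p.1 ≠ p.2).biUnion fun p => A.nbhd p.1 p.2 (f p.1) (f p.2)

/-- The pair consisting of a transversal `T` on `Sh × B` and a transversal `U` on `Sh × C`
has `δ`-intersecting links. -/
def IntersectingLinks (δ : ℝ) (Sh B C : Finset ℕ) (T U : ℕ → ℕ → ℕ) : Prop :=
  ∀ a ∈ Sh, ∀ a' ∈ Sh, a ≠ a' → ∀ b ∈ B, ∀ c ∈ C,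
    δ * ((A.P a a').card : ℝ) ≤
      (((A.nbhd a a' (T a b) (T a' b)) ∩ (A.nbhd a a' (U a c) (U a' c))).card : ℝ)

/-- The pair consisting of a transversal `T` on `Sh × B` and a transversal `U` on `Sh × C`
has `δ`-disjoint links. -/
def DisjointLinks (δ : ℝ) (Sh B C : Finset ℕ) (T U : ℕ → ℕ → ℕ) : Prop :=
  ∀ a ∈ Sh, ∀ a' ∈ Sh, a ≠ a' → ∀ b ∈ B, ∀ c ∈ C,
    (((A.nbhd a a' (T a b) (T a' b)) ∩ (A.nbhd a a' (U a c) (U a' c))).card : ℝ) <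
      δ * ((A.P a a').card : ℝ)

/-- A bicolouring of the reduced hypergraph: both colours appear in every vertex class and
no edge is monochromatic. -/
def IsBicolouring (φ : ℕ → Bool) : Prop :=
  (∀ i ∈ A.I, ∀ j ∈ A.I, i ≠ j →
    (∃ v ∈ A.P i j, φ v = true) ∧ (∃ v ∈ A.P i j, φ v = false)) ∧
  ∀ a b c, A.Edge a b c → ¬ (φ a = φ b ∧ φ b = φ c)

/-- The minimum monochromatic codegree density is at least `x`: `τ₂(A, φ) ≥ x`. -/
def Tau2Ge (φ : ℕ → Bool) (x : ℝ) : Prop :=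
  ∀ i j k, i ∈ A.I → j ∈ A.I → k ∈ A.I → i ≠ j → i ≠ k → j ≠ k →
    ∀ a ∈ A.P i j, ∀ b ∈ A.P i k, φ a = φ b →
      x * ((A.P j k).card : ℝ) ≤ ((A.nbhd j k a b).card : ℝ)

/-- The `γ`-bad left cherries (both vertices in one hole, many neighbours outside
the other hole). -/
def badLeft (Φ Ψ : Finset ℕ) (γ : ℝ) (i j k : ℕ) : Finset (ℕ × ℕ) :=
  (A.P i j ×ˢ A.P i k).filter fun p =>
    (p.1 ∈ Φ ∧ p.2 ∈ Φ ∧ γ * ((A.P j k).card : ℝ) ≤ (((A.nbhd j k p.1 p.2) \ Ψ).card : ℝ)) ∨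
    (p.1 ∈ Ψ ∧ p.2 ∈ Ψ ∧ γ * ((A.P j k).card : ℝ) ≤ (((A.nbhd j k p.1 p.2) \ Φ).card : ℝ))

/-- The `γ`-bad middle cherries. -/
def badMid (Φ Ψ : Finset ℕ) (γ : ℝ) (i j k : ℕ) : Finset (ℕ × ℕ) :=
  (A.P i j ×ˢ A.P j k).filter fun p =>
    (p.1 ∈ Φ ∧ p.2 ∈ Φ ∧ γ * ((A.P i k).card : ℝ) ≤ (((A.nbhd i k p.1 p.2) \ Ψ).card : ℝ)) ∨
    (p.1 ∈ Ψ ∧ p.2 ∈ Ψ ∧ γ * ((A.P i k).card : ℝ) ≤ (((A.nbhd i k p.1 p.2) \ Φ).card : ℝ))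

/-- The `γ`-bad right cherries. -/
def badRight (Φ Ψ : Finset ℕ) (γ : ℝ) (i j k : ℕ) : Finset (ℕ × ℕ) :=
  (A.P i k ×ˢ A.P j k).filter fun p =>
    (p.1 ∈ Φ ∧ p.2 ∈ Φ ∧ γ * ((A.P i j).card : ℝ) ≤ (((A.nbhd i j p.1 p.2) \ Ψ).card : ℝ)) ∨
    (p.1 ∈ Ψ ∧ p.2 ∈ Ψ ∧ γ * ((A.P i j).card : ℝ) ≤ (((A.nbhd i j p.1 p.2) \ Φ).card : ℝ))

end ReducedHG

/-- Ramsey for a single set. -/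
theorem rams1 (r : ℕ) : ∀ (κ : Type) [Finite κ] [Nonempty κ] (t : ℕ), ∃ s : ℕ, ∀ K : Finset ℕ, s ≤ K.card →
    ∀ c : Finset ℕ → κ, ∃ Ks ⊆ K, t ≤ Ks.card ∧ ∃ col : κ, ∀ X ⊆ Ks, X.card = r → c X = col := by
  induction r with
  | zero =>
    intro κ _ _ t
    refine ⟨t, fun K hK c => ⟨K, subset_rfl, hK, c ∅, fun X _ hX => ?_⟩⟩
    rw [Finset.card_eq_zero.mp hX]
  | succ r ih =>
    intro κ _ _ t
    have key : ∀ n : ℕ, ∃ s : ℕ, ∀ K : Finset ℕ, s ≤ K.card → ∀ c : Finset ℕ → κ,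
        ∃ B ⊆ K, n ≤ B.card ∧ ∃ g : ℕ → κ, ∀ X ⊆ B, X.card = r + 1 → ∀ x ∈ X,
          (∀ y ∈ X, x ≤ y) → c X = g x := by
      intro n
      induction n with
      | zero =>
        refine ⟨0, fun K hK c => ⟨∅, by simp, by simp, fun _ => Classical.arbitrary κ, ?_⟩⟩
        intro X hX hc
        rw [Finset.subset_empty.mp hX] at hc
        simp at hc
      | succ n ihn =>
        obtain ⟨s0, hs0⟩ := ihn
        obtain ⟨s1, hs1⟩ := ih κ s0
        refine ⟨s1 + 1, fun K hK c => ?_⟩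
        have hne : K.Nonempty := Finset.card_pos.mp (by omega)
        set a := K.min' hne with ha
        have haK : a ∈ K := K.min'_mem hne
        obtain ⟨K1, hK1, hc1, col, hcol⟩ := hs1 (K.erase a)
          (by rw [Finset.card_erase_of_mem haK]; omega) (fun X => c (insert a X))
        obtain ⟨B, hB, hBc, g, hg⟩ := hs0 K1 hc1 c
        have hlt : ∀ b ∈ B, a < b := by
          intro b hb
          have h1 := Finset.mem_erase.mp (hK1 (hB hb))
          exact lt_of_le_of_ne (K.min'_le b h1.2) (Ne.symm h1.1)
        have haB : a ∉ B := fun h => lt_irrefl _ (hlt a h)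
        refine ⟨insert a B, ?_, ?_, fun x => if x = a then col else g x, ?_⟩
        · intro x hx
          rcases Finset.mem_insert.mp hx with rfl | hx
          · exact haK
          · exact Finset.mem_of_mem_erase (hK1 (hB hx))
        · rw [Finset.card_insert_of_notMem haB]; omega
        · intro X hX hXc x hx hmin
          by_cases hax : a ∈ X
          · have hxa : x = a := by
              rcases Finset.mem_insert.mp (hX hx) with h | h
              · exact h
              · have := hlt x h
                have := hmin a hax
                omega
            have h1 : X.erase a ⊆ K1 := by
              intro y hy
              have hy' := Finset.mem_erase.mp hy
              rcases Finset.mem_insert.mp (hX hy'.2) with h | h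
              · exact absurd h hy'.1
              · exact hB h
            have h2 := hcol (X.erase a) h1 (by rw [Finset.card_erase_of_mem hax]; omega)
            simp only [Finset.insert_erase hax] at h2
            simp [hxa, h2]
          · have hXB : X ⊆ B := by
              intro y hy
              rcases Finset.mem_insert.mp (hX hy) with h | h
              · exact absurd (h ▸ hy) hax
              · exact h
            have hxa : x ≠ a := fun h => hax (h ▸ hx)
            simp only [hxa, if_false]
            exact hg X hXB hXc x hx hmin
    have := Fintype.ofFinite κ
    obtain ⟨s, hs⟩ := key (Fintype.card κ * t)
    refine ⟨s, fun K hK c => ?_⟩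
    obtain ⟨B, hB, hBc, g, hg⟩ := hs K hK c
    obtain ⟨col, -, hcol⟩ := Finset.exists_le_card_fiber_of_mul_le_card_of_maps_to
      (s := B) (t := (Finset.univ : Finset κ)) (f := g) (n := t) (fun _ _ => Finset.mem_univ _)
      Finset.univ_nonempty (by simpa using hBc)
    refine ⟨B.filter (fun x => g x = col), (Finset.filter_subset _ _).trans hB, hcol, col, ?_⟩
    intro X hX hXc
    have hne : X.Nonempty := Finset.card_pos.mp (by omega)
    rw [hg X (hX.trans (Finset.filter_subset _ _)) hXc (X.min' hne) (X.min'_mem hne)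
      (fun y hy => X.min'_le y hy)]
    exact (Finset.mem_filter.mp (hX (X.min'_mem hne))).2

theorem emb_fin (s : ℕ) (K : Finset ℕ) (h : s ≤ K.card) : ∃ K0 ⊆ K, s ≤ K0.card ∧ ∃ e : Fin s → ℕ,
    ∀ X ⊆ K0, (Finset.univ.filter (fun i => e i ∈ X)).image e = X := by
  obtain ⟨K0, h0, h1⟩ := Finset.exists_subset_card_eq h
  refine ⟨K0, h0, h1.ge, K0.orderEmbOfFin h1, fun X hX => ?_⟩
  ext x
  simp only [Finset.mem_image, Finset.mem_filter, Finset.mem_univ, true_and]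
  constructor
  · rintro ⟨i, hi, rfl⟩; exact hi
  · intro hx
    have : x ∈ Set.range (K0.orderEmbOfFin h1) := by
      rw [Finset.range_orderEmbOfFin]; exact hX hx
    obtain ⟨i, rfl⟩ := this
    exact ⟨i, hx, rfl⟩

theorem rams3 (r1 r2 r3 t : ℕ) : ∃ s : ℕ, ∀ K L M : Finset ℕ, s ≤ K.card → s ≤ L.card → s ≤ M.card →
    ∀ p : Finset ℕ → Finset ℕ → Finset ℕ → Prop, ∃ Ks Ls Ms : Finset ℕ, Ks ⊆ K ∧ Ls ⊆ L ∧ Ms ⊆ M ∧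
      t ≤ Ks.card ∧ t ≤ Ls.card ∧ t ≤ Ms.card ∧ ∃ col : Prop,
        ∀ X ⊆ Ks, ∀ Y ⊆ Ls, ∀ Z ⊆ Ms, X.card = r1 → Y.card = r2 → Z.card = r3 → (p X Y Z ↔ col) := by
  obtain ⟨s3, h3⟩ := rams1 r3 Prop t
  obtain ⟨s2, h2⟩ := rams1 r2 (Finset (Fin s3) → Prop) t
  obtain ⟨s1, h1⟩ := rams1 r1 (Finset (Fin s2) → Finset (Fin s3) → Prop) t
  refine ⟨max s1 (max s2 s3), fun K L M hK hL hM p => ?_⟩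
  obtain ⟨L0, hL0, hL0c, e2, he2⟩ := emb_fin s2 L (by omega)
  obtain ⟨M0, hM0, hM0c, e3, he3⟩ := emb_fin s3 M (by omega)
  obtain ⟨Ks, hKs, hKc, c1, hc1⟩ := h1 K (by omega) (fun X Y Z => p X (Y.image e2) (Z.image e3))
  obtain ⟨Ls, hLs, hLc, c2, hc2⟩ := h2 L0 hL0c (fun Y Z => c1 (Finset.univ.filter (fun i => e2 i ∈ Y)) Z)
  obtain ⟨Ms, hMs, hMc, c3, hc3⟩ := h3 M0 hM0c (fun Z => c2 (Finset.univ.filter (fun i => e3 i ∈ Z)))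
  refine ⟨Ks, Ls, Ms, hKs, hLs.trans hL0, hMs.trans hM0, hKc, hLc, hMc, c3, ?_⟩
  intro X hX Y hY Z hZ hXc hYc hZc
  have a1 := congrFun (congrFun (hc1 X hX hXc) (Finset.univ.filter (fun i => e2 i ∈ Y)))
    (Finset.univ.filter (fun i => e3 i ∈ Z))
  have a2 := congrFun (hc2 Y hY hYc) (Finset.univ.filter (fun i => e3 i ∈ Z))
  have a3 := hc3 Z hZ hZc
  rw [he2 Y (hY.trans hLs), he3 Z (hZ.trans hMs)] at a1
  rw [a1, a2, a3]

/-- unavoidable implies everywhere -/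
theorem everywhere (a b t N : ℕ) : ∃ s : ℕ, ∀ K L : Finset ℕ, s ≤ K.card → s ≤ L.card →
    ∀ p : Finset ℕ → Finset ℕ → Prop,
    (∀ K' ⊆ K, ∀ L' ⊆ L, N ≤ K'.card → N ≤ L'.card →
      ∃ X ⊆ K', ∃ Y ⊆ L', X.card = a ∧ Y.card = b ∧ p X Y) →
    ∃ Ks Ls : Finset ℕ, Ks ⊆ K ∧ Ls ⊆ L ∧ t ≤ Ks.card ∧ t ≤ Ls.card ∧
      ∀ X ⊆ Ks, ∀ Y ⊆ Ls, X.card = a → Y.card = b → p X Y := by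
  obtain ⟨s, hs⟩ := rams3 a b 0 (max t N)
  refine ⟨s, fun K L hK hL p hp => ?_⟩
  obtain ⟨Ks, Ls, Ms, hKs, hLs, -, hKc, hLc, -, col, hcol⟩ := hs K L K hK hL hK (fun X Y _ => p X Y)
  refine ⟨Ks, Ls, hKs, hLs, by omega, by omega, ?_⟩
  obtain ⟨X0, hX0, Y0, hY0, hXc0, hYc0, h0⟩ := hp Ks hKs Ls hLs (by omega) (by omega)
  have hc : col := (hcol X0 hX0 Y0 hY0 ∅ (by simp) hXc0 hYc0 rfl).mp h0
  intro X hX Y hY hXc hYc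
  exact (hcol X hX Y hY ∅ (by simp) hXc hYc rfl).mpr hc

theorem colour4 (t : ℕ) : ∃ s : ℕ, ∀ K L M : Finset ℕ, s ≤ K.card → s ≤ L.card → s ≤ M.card →
    ∀ p : ℕ → ℕ → ℕ → ℕ → Prop, ∃ Ks Ls Ms : Finset ℕ, Ks ⊆ K ∧ Ls ⊆ L ∧ Ms ⊆ M ∧
      t ≤ Ks.card ∧ t ≤ Ls.card ∧ t ≤ Ms.card ∧
      ((∀ k ∈ Ks, ∀ k' ∈ Ks, k < k' → ∀ l ∈ Ls, ∀ m ∈ Ms, p k k' l m) ∨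
       (∀ k ∈ Ks, ∀ k' ∈ Ks, k < k' → ∀ l ∈ Ls, ∀ m ∈ Ms, ¬ p k k' l m)) := by
  obtain ⟨s, hs⟩ := rams3 2 1 1 t
  refine ⟨s, fun K L M hK hL hM p => ?_⟩
  obtain ⟨Ks, Ls, Ms, hKs, hLs, hMs, hKc, hLc, hMc, col, hcol⟩ := hs K L M hK hL hM
    (fun X Y Z => ∃ k ∈ X, ∃ k' ∈ X, k < k' ∧ ∃ l ∈ Y, ∃ m ∈ Z, p k k' l m)
  refine ⟨Ks, Ls, Ms, hKs, hLs, hMs, hKc, hLc, hMc, ?_⟩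
  have key : ∀ k ∈ Ks, ∀ k' ∈ Ks, k < k' → ∀ l ∈ Ls, ∀ m ∈ Ms, (p k k' l m ↔ col) := by
    intro k hk k' hk' hkk l hl m hm
    rw [← hcol {k, k'} (by simp [Finset.insert_subset_iff, hk, hk']) {l} (by simpa) {m} (by simpa)
      (Finset.card_pair hkk.ne) (by simp) (by simp)]
    simp only [Finset.mem_insert, Finset.mem_singleton, exists_eq_left]
    constructor
    · intro h; exact ⟨k, Or.inl rfl, k', Or.inr rfl, hkk, h⟩
    · rintro ⟨x, rfl | rfl, y, rfl | rfl, h, hp⟩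
      · omega
      · exact hp
      · omega
      · omega
  by_cases h : col
  · left; intro k hk k' hk' hkk l hl m hm; exact (key k hk k' hk' hkk l hl m hm).mpr h
  · right; intro k hk k' hk' hkk l hl m hm h'; exact h ((key k hk k' hk' hkk l hl m hm).mp h')

theorem pigeon {α : Type} (a : ℕ) (ε : ℝ) (Ω : Finset α) (hΩ : Ω.Nonempty)
    (T : Finset ℕ) (F : ℕ → Finset α) (hF : ∀ i ∈ T, F i ⊆ Ω)
    (hc : ∀ i ∈ T, ε * (Ω.card : ℝ) ≤ ((F i).card : ℝ)) (hT : (a : ℝ) ≤ T.card * ε) :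
    ∃ X ⊆ T, X.card = a ∧ ∃ w ∈ Ω, ∀ i ∈ X, w ∈ F i := by
  classical
  by_contra hcon
  push Not at hcon
  have hlt : ∀ w ∈ Ω, ((T.filter (fun i => w ∈ F i)).card) < a := by
    intro w hw
    by_contra h
    push Not at h
    obtain ⟨X, hX, hXc⟩ := Finset.exists_subset_card_eq h
    obtain ⟨i, hi, hi'⟩ := hcon X (hX.trans (Finset.filter_subset _ _)) hXc w hw
    exact hi' (Finset.mem_filter.mp (hX hi)).2
  have hsum : ∑ i ∈ T, (F i).card = ∑ w ∈ Ω, (T.filter (fun i => w ∈ F i)).card := by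
    have h1 : ∀ i ∈ T, (F i).card = ∑ w ∈ Ω, if w ∈ F i then 1 else 0 := by
      intro i hi
      rw [← Finset.card_filter]
      congr 1
      ext w
      simp only [Finset.mem_filter]
      exact ⟨fun h => ⟨hF i hi h, h⟩, fun h => h.2⟩
    rw [Finset.sum_congr rfl h1, Finset.sum_comm]
    refine Finset.sum_congr rfl fun w _ => ?_
    rw [Finset.card_filter]
  have h2 : ∑ w ∈ Ω, (T.filter (fun i => w ∈ F i)).card < ∑ w ∈ Ω, a :=
    Finset.sum_lt_sum_of_nonempty hΩ hlt
  have h3 : (T.card : ℝ) * (ε * Ω.card) ≤ ∑ i ∈ T, ((F i).card : ℝ) := by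
    have := Finset.card_nsmul_le_sum T (fun i => ((F i).card : ℝ)) _ hc
    simpa using this
  have h4 : ((∑ i ∈ T, (F i).card : ℕ) : ℝ) < (Ω.card : ℝ) * a := by
    rw [hsum]
    have : ((∑ w ∈ Ω, (T.filter (fun i => w ∈ F i)).card : ℕ) : ℝ) < ((∑ w ∈ Ω, a : ℕ) : ℝ) := by
      exact_mod_cast h2
    simpa using this
  push_cast at h4
  have h5 : (0 : ℝ) ≤ Ω.card := by positivity
  nlinarith

theorem two_of_card {K : Finset ℕ} (h : 2 ≤ K.card) : ∃ k ∈ K, ∃ k' ∈ K, k < k' := by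
  obtain ⟨a, ha, b, hb, hab⟩ := Finset.one_lt_card.mp h
  rcases lt_or_gt_of_ne hab with h | h
  · exact ⟨a, ha, b, hb, h⟩
  · exact ⟨b, hb, a, ha, h⟩

theorem three_of_card {K : Finset ℕ} (h : 3 ≤ K.card) : ∃ i ∈ K, ∃ j ∈ K, ∃ k ∈ K, i < j ∧ j < k := by
  obtain ⟨X, hX, hc⟩ := Finset.exists_subset_card_eq h
  have m := fun i => hX (X.orderEmbOfFin_mem hc i)
  exact ⟨_, m 0, _, m 1, _, m 2, (X.orderEmbOfFin hc).strictMono (by decide),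
    (X.orderEmbOfFin hc).strictMono (by decide)⟩

theorem commonPt (a : ℕ) (ε : ℝ) (hε : 0 < ε) (t : ℕ) : ∃ s : ℕ, ∀ K L : Finset ℕ,
    s ≤ K.card → s ≤ L.card → ∀ (F : ℕ → ℕ → ℕ → Finset ℕ) (Ω : ℕ → ℕ → Finset ℕ),
    (∀ l ∈ L, ∀ l' ∈ L, l < l' → (Ω l l').Nonempty ∧ ∀ k ∈ K, F k l l' ⊆ Ω l l' ∧
      ε * ((Ω l l').card : ℝ) ≤ ((F k l l').card : ℝ)) →
    ∃ Ks Ls : Finset ℕ, Ks ⊆ K ∧ Ls ⊆ L ∧ t ≤ Ks.card ∧ t ≤ Ls.card ∧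
      ∀ X ⊆ Ks, X.card = a → ∀ l ∈ Ls, ∀ l' ∈ Ls, l < l' → ∃ w ∈ Ω l l', ∀ k ∈ X, w ∈ F k l l' := by
  obtain ⟨n, hn⟩ := exists_nat_ge ((a : ℝ) / ε)
  obtain ⟨s, hs⟩ := everywhere a 2 t (n + 2)
  refine ⟨s, fun K L hK hL F Ω h => ?_⟩
  obtain ⟨Ks, Ls, hKs, hLs, hKc, hLc, hp⟩ := hs K L hK hL
    (fun X Y => ∀ l ∈ Y, ∀ l' ∈ Y, l < l' → ∃ w ∈ Ω l l', ∀ k ∈ X, w ∈ F k l l') (by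
      intro K' hK' L' hL' hKn hLn
      obtain ⟨l, hl, l', hl', hll⟩ := two_of_card (K := L') (by omega)
      obtain ⟨hne, hf⟩ := h l (hL' hl) l' (hL' hl') hll
      obtain ⟨X, hX, hXc, w, hw, hwF⟩ := pigeon a ε (Ω l l') hne K' (fun k => F k l l')
        (fun k hk => (hf k (hK' hk)).1) (fun k hk => (hf k (hK' hk)).2) (by
          rw [div_le_iff₀ hε] at hn
          have : (n : ℝ) ≤ K'.card := by exact_mod_cast (by omega : n ≤ K'.card)
          nlinarith)
      refine ⟨X, hX, {l, l'}, by simp [Finset.insert_subset_iff, hl, hl'], hXc,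
        Finset.card_pair hll.ne, ?_⟩
      intro x hx y hy hxy
      simp only [Finset.mem_insert, Finset.mem_singleton] at hx hy
      rcases hx with rfl | rfl <;> rcases hy with rfl | rfl
      · omega
      · exact ⟨w, hw, hwF⟩
      · omega
      · omega)
  refine ⟨Ks, Ls, hKs, hLs, hKc, hLc, ?_⟩
  intro X hX hXc l hl l' hl' hll
  exact hp X hX {l, l'} (by simp [Finset.insert_subset_iff, hl, hl']) hXc
    (Finset.card_pair hll.ne) l (by simp) l' (by simp) hll

theorem symm3 {α : Type} [LinearOrder α] (S : Finset α) (G : α → α → α → Prop)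
    (h1 : ∀ i ∈ S, ∀ j ∈ S, ∀ k ∈ S, G i j k → G j i k)
    (h2 : ∀ i ∈ S, ∀ j ∈ S, ∀ k ∈ S, G i j k → G i k j)
    (h : ∀ i ∈ S, ∀ j ∈ S, ∀ k ∈ S, i < j → j < k → G i j k) :
    ∀ i ∈ S, ∀ j ∈ S, ∀ k ∈ S, i ≠ j → i ≠ k → j ≠ k → G i j k := by
  intro i hi j hj k hk hij hik hjk
  rcases lt_or_gt_of_ne hij with a | a <;> rcases lt_or_gt_of_ne hik with b | b <;>
    rcases lt_or_gt_of_ne hjk with c | c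
  · exact h i hi j hj k hk a c
  · exact h2 _ hi _ hk _ hj (h i hi k hk j hj b c)
  · exact absurd (a.trans c) (not_lt_of_gt b)
  · exact h2 _ hi _ hk _ hj (h1 _ hk _ hi _ hj (h k hk i hi j hj b a))
  · exact h1 _ hj _ hi _ hk (h j hj i hi k hk a b)
  · exact absurd (c.trans a) (not_lt_of_gt b)
  · exact h1 _ hj _ hi _ hk (h2 _ hj _ hk _ hi (h j hj k hk i hi c b))
  · exact h1 _ hj _ hi _ hk (h2 _ hj _ hk _ hi (h1 _ hk _ hj _ hi (h k hk j hj i hi c a)))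

namespace ReducedHG

theorem k5_fin (A : ReducedHG) (x : Fin 5 → ℕ) (hx : Function.Injective x) (hI : ∀ i, x i ∈ A.I)
    (V : Fin 5 → Fin 5 → ℕ) (hV : ∀ i j, V i j = V j i)
    (hP : ∀ i j, i < j → V i j ∈ A.P (x i) (x j))
    (hE : ∀ i j k, i < j → j < k → A.Edge (V i j) (V i k) (V j k)) : A.SupportsK5 := by
  have hinv : ∀ i, Function.invFun x (x i) = i := Function.leftInverse_invFun hx
  have hE' := symm3 (Finset.univ : Finset (Fin 5)) (fun i j k => A.Edge (V i j) (V i k) (V j k))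
    (fun i _ j _ k _ h => by
      simp only [hV j i]; exact A.EdgeSymm' _ _ _ h)
    (fun i _ j _ k _ h => by
      simp only [hV k j]; exact A.EdgeSymm _ _ _ h)
    (fun i _ j _ k _ h h' => hE i j k h h')
  refine ⟨Finset.univ.image x, ?_, ?_, fun i j => V (Function.invFun x i) (Function.invFun x j), ?_, ?_, ?_⟩
  · intro y hy
    obtain ⟨i, -, rfl⟩ := Finset.mem_image.mp hy
    exact hI i
  · rw [Finset.card_image_of_injective _ hx]; simp
  · intro i _ j _; exact hV _ _
  · simp only [Finset.mem_image, Finset.mem_univ, true_and, forall_exists_index, forall_apply_eq_imp_iff, hinv]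
    intro i j hij
    have hij' : i ≠ j := fun h => hij (by rw [h])
    rcases lt_or_gt_of_ne hij' with h | h
    · exact hP i j h
    · rw [hV, A.Psymm]; exact hP j i h
  · simp only [Finset.mem_image, Finset.mem_univ, true_and, forall_exists_index, forall_apply_eq_imp_iff, hinv]
    intro i j k h1 h2 h3
    exact hE' i (Finset.mem_univ _) j (Finset.mem_univ _) k (Finset.mem_univ _)
      (fun h => h1 (by rw [h])) (fun h => h2 (by rw [h])) (fun h => h3 (by rw [h]))

theorem k5_mk (A : ReducedHG) (a b c d e : ℕ) (ha : a ∈ A.I) (hb : b ∈ A.I) (hc : c ∈ A.I)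
    (hd : d ∈ A.I) (he : e ∈ A.I) (hnd : [a, b, c, d, e].Nodup)
    (ab ac ad ae bc bd be cd ce de : ℕ)
    (mab : ab ∈ A.P a b) (mac : ac ∈ A.P a c) (mad : ad ∈ A.P a d) (mae : ae ∈ A.P a e)
    (mbc : bc ∈ A.P b c) (mbd : bd ∈ A.P b d) (mbe : be ∈ A.P b e)
    (mcd : cd ∈ A.P c d) (mce : ce ∈ A.P c e) (mde : de ∈ A.P d e)
    (h1 : A.Edge ab ac bc) (h2 : A.Edge ab ad bd) (h3 : A.Edge ab ae be)
    (h4 : A.Edge ac ad cd) (h5 : A.Edge ac ae ce) (h6 : A.Edge ad ae de)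
    (h7 : A.Edge bc bd cd) (h8 : A.Edge bc be ce) (h9 : A.Edge bd be de)
    (h10 : A.Edge cd ce de) : A.SupportsK5 := by
  refine k5_fin A ![a, b, c, d, e] ?_ ?_ ![![0, ab, ac, ad, ae], ![ab, 0, bc, bd, be],
    ![ac, bc, 0, cd, ce], ![ad, bd, cd, 0, de], ![ae, be, ce, de, 0]] ?_ ?_ ?_
  · simp only [List.nodup_cons, List.mem_cons, List.not_mem_nil, not_or] at hnd
    intro i j hij
    fin_cases i <;> fin_cases j <;> simp_all
  · intro i; fin_cases i <;> simpa
  · intro i j; fin_cases i <;> fin_cases j <;> rfl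
  · intro i j hij
    fin_cases i <;> fin_cases j <;> first | exact absurd hij (by decide) | assumption
  · intro i j k hij hjk
    fin_cases i <;> fin_cases j <;> first | exact absurd hij (by decide) | skip
    all_goals fin_cases k <;> first | exact absurd hjk (by decide) | assumption

theorem mem_nbhd (A : ReducedHG) {j k a b c : ℕ} : c ∈ A.nbhd j k a b ↔ c ∈ A.P j k ∧ A.Edge a b c := by
  simp [nbhd]

theorem nbhd_symm (A : ReducedHG) (j k a b : ℕ) : A.nbhd j k a b = A.nbhd k j b a := by
  ext c
  rw [mem_nbhd, mem_nbhd, A.Psymm]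
  exact and_congr_right fun _ => ⟨A.EdgeSymm _ _ _, A.EdgeSymm _ _ _⟩

theorem nbhd_sub (A : ReducedHG) (j k a b : ℕ) : A.nbhd j k a b ⊆ A.P j k := Finset.filter_subset _ _

/-- Edge in the rotated order. -/
theorem rot (A : ReducedHG) {a b c : ℕ} (h : A.Edge a b c) : A.Edge b c a :=
  A.EdgeSymm' _ _ _ (A.EdgeSymm _ _ _ h)

theorem cross (δ : ℝ) (hδ : 0 < δ) : ∃ s : ℕ, ∀ (A : ReducedHG) (K L : Finset ℕ) (m : ℕ),
    K ⊆ A.I → L ⊆ A.I → m ∈ A.I → Disjoint K L → m ∉ K → m ∉ L → s ≤ K.card → s ≤ L.card →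
    ∀ (Q : ℕ → ℕ → ℕ) (r q : ℕ → ℕ), (∀ k ∈ K, ∀ l ∈ L, Q k l ∈ A.P k l) →
    (∀ k ∈ K, r k ∈ A.P k m) → (∀ l ∈ L, q l ∈ A.P l m) →
    (∀ k ∈ K, ∀ l ∈ L, A.Edge (Q k l) (r k) (q l)) →
    (∀ k ∈ K, ∀ k' ∈ K, k ≠ k' → ∀ l ∈ L, δ * ((A.P k k').card : ℝ) ≤
      ((A.nbhd k k' (Q k l) (Q k' l) ∩ A.nbhd k k' (r k) (r k')).card : ℝ)) →
    (∀ l ∈ L, ∀ l' ∈ L, l ≠ l' → ∀ k ∈ K, δ * ((A.P l l').card : ℝ) ≤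
      ((A.nbhd l l' (Q k l) (Q k l') ∩ A.nbhd l l' (q l) (q l')).card : ℝ)) →
    A.SupportsK5 := by
  obtain ⟨n, hn⟩ := exists_nat_ge ((2 : ℝ) / δ)
  obtain ⟨s, hs⟩ := commonPt 2 δ hδ (n + 2)
  refine ⟨s, fun A K L m hKI hLI hmI hKL hmK hmL hKc hLc Q r q hQ hr hq hE hK hL => ?_⟩
  obtain ⟨Ks, Ls, hKs, hLs, hKsc, hLsc, hp⟩ := hs K L hKc hLc
    (fun k l l' => A.nbhd l l' (Q k l) (Q k l') ∩ A.nbhd l l' (q l) (q l')) (fun l l' => A.P l l')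
    (fun l hl l' hl' hll => ⟨A.Pnonempty _ _ (hLI hl) (hLI hl') hll.ne, fun k hk =>
      ⟨Finset.inter_subset_left.trans (A.nbhd_sub _ _ _ _), hL l hl l' hl' hll.ne k hk⟩⟩)
  obtain ⟨k, hk, k', hk', hkk⟩ := two_of_card (K := Ks) (by omega)
  obtain ⟨Y, hY, hYc, v, hv, hvF⟩ := pigeon 2 δ (A.P k k')
    (A.Pnonempty _ _ (hKI (hKs hk)) (hKI (hKs hk')) hkk.ne) Ls
    (fun l => A.nbhd k k' (Q k l) (Q k' l) ∩ A.nbhd k k' (r k) (r k'))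
    (fun l hl => Finset.inter_subset_left.trans (A.nbhd_sub _ _ _ _))
    (fun l hl => hK k (hKs hk) k' (hKs hk') hkk.ne l (hLs hl)) (by
      rw [div_le_iff₀ hδ] at hn
      have : (n : ℝ) ≤ Ls.card := by exact_mod_cast (by omega : n ≤ Ls.card)
      push_cast
      nlinarith)
  obtain ⟨l, hl, l', hl', hll⟩ := two_of_card (K := Y) (by omega)
  obtain ⟨w, hw, hwF⟩ := hp {k, k'} (by simp [Finset.insert_subset_iff, hk, hk'])
    (Finset.card_pair hkk.ne) l (hY hl) l' (hY hl') hll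
  have v1 := hvF l hl
  have v2 := hvF l' hl'
  have w1 := hwF k (by simp)
  have w2 := hwF k' (by simp)
  simp only [Finset.mem_inter, mem_nbhd] at v1 v2 w1 w2
  have ek := hKs hk
  have ek' := hKs hk'
  have el := hLs (hY hl)
  have el' := hLs (hY hl')
  have dj : ∀ x ∈ K, ∀ y ∈ L, x ≠ y := fun x hx y hy h => Finset.disjoint_left.mp hKL hx (h ▸ hy)
  refine k5_mk A k k' l l' m (hKI ek) (hKI ek') (hLI el) (hLI el') hmI ?_
    v (Q k l) (Q k l') (r k) (Q k' l) (Q k' l') (r k') w (q l) (q l') hv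
    (hQ _ ek _ el) (hQ _ ek _ el') (hr _ ek) (hQ _ ek' _ el) (hQ _ ek' _ el') (hr _ ek') hw
    (hq _ el) (hq _ el') (A.rot (A.rot v1.1.2)) (A.rot (A.rot v2.1.2)) (A.rot (A.rot v1.2.2))
    w1.1.2 (hE _ ek _ el) (hE _ ek _ el') w2.1.2 (hE _ ek' _ el) (hE _ ek' _ el')
    (A.rot (A.rot w1.2.2))
  have n1 : k ≠ m := fun h => hmK (h ▸ ek)
  have n2 : k' ≠ m := fun h => hmK (h ▸ ek')
  have n3 : l ≠ m := fun h => hmL (h ▸ el)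
  have n4 : l' ≠ m := fun h => hmL (h ▸ el')
  simp [hkk.ne, hll.ne, dj k ek l el, dj k ek l' el', dj k' ek' l el, dj k' ek' l' el', n1, n2, n3, n4]

def Few (A : ReducedHG) (μ : ℝ) (f : ℕ → ℕ) (i j k : ℕ) : Prop :=
  (A.ecount (A.nbhd i j (f i) (f j)) (A.nbhd i k (f i) (f k)) (A.nbhd j k (f j) (f k)) : ℝ) ≤
      μ * (((A.P i j).card : ℝ) * ((A.P i k).card : ℝ) * ((A.P j k).card : ℝ))

theorem ecount_swap1 (A : ReducedHG) (X Y Z : Finset ℕ) : A.ecount X Y Z = A.ecount Y X Z := by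
  unfold ecount
  refine Finset.card_bij' (fun t _ => (t.2.1, t.1, t.2.2)) (fun t _ => (t.2.1, t.1, t.2.2)) ?_ ?_ ?_ ?_
  · intro t ht
    simp only [Finset.mem_filter, Finset.mem_product] at ht ⊢
    exact ⟨⟨ht.1.2.1, ht.1.1, ht.1.2.2⟩, A.EdgeSymm _ _ _ ht.2⟩
  · intro t ht
    simp only [Finset.mem_filter, Finset.mem_product] at ht ⊢
    exact ⟨⟨ht.1.2.1, ht.1.1, ht.1.2.2⟩, A.EdgeSymm _ _ _ ht.2⟩
  · intro t _; rfl
  · intro t _; rfl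

theorem ecount_swap2 (A : ReducedHG) (X Y Z : Finset ℕ) : A.ecount X Y Z = A.ecount X Z Y := by
  unfold ecount
  refine Finset.card_bij' (fun t _ => (t.1, t.2.2, t.2.1)) (fun t _ => (t.1, t.2.2, t.2.1)) ?_ ?_ ?_ ?_
  · intro t ht
    simp only [Finset.mem_filter, Finset.mem_product] at ht ⊢
    exact ⟨⟨ht.1.1, ht.1.2.2, ht.1.2.1⟩, A.EdgeSymm' _ _ _ ht.2⟩
  · intro t ht
    simp only [Finset.mem_filter, Finset.mem_product] at ht ⊢
    exact ⟨⟨ht.1.1, ht.1.2.2, ht.1.2.1⟩, A.EdgeSymm' _ _ _ ht.2⟩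
  · intro t _; rfl
  · intro t _; rfl

theorem few_all (A : ReducedHG) (μ : ℝ) (f : ℕ → ℕ) (S : Finset ℕ)
    (h : ∀ i ∈ S, ∀ j ∈ S, ∀ k ∈ S, i < j → j < k → A.Few μ f i j k) :
    ∀ i ∈ S, ∀ j ∈ S, ∀ k ∈ S, i ≠ j → i ≠ k → j ≠ k → A.Few μ f i j k := by
  refine symm3 S (fun i j k => A.Few μ f i j k) ?_ ?_ h
  · intro i _ j _ k _ h
    unfold Few at h ⊢
    rw [A.nbhd_symm j i, A.Psymm j i, ecount_swap2]
    linarith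
  · intro i _ j _ k _ h
    unfold Few at h ⊢
    rw [A.nbhd_symm k j, A.Psymm k j, ecount_swap1]
    linarith

theorem holes (t : ℕ) (μ d : ℝ) (hμ : 0 < μ) (hd : 0 < d) : ∃ s : ℕ, ∀ (A : ReducedHG) (K L : Finset ℕ),
    A.EEDense d → ¬ A.SupportsK5 → K ⊆ A.I → L ⊆ A.I → Disjoint K L → s ≤ K.card → s ≤ L.card →
    ∀ (Q : ℕ → ℕ → ℕ), (∀ k ∈ K, ∀ l ∈ L, Q k l ∈ A.P k l) →
    ∃ Ks Ls : Finset ℕ, Ks ⊆ K ∧ Ls ⊆ L ∧ t ≤ Ks.card ∧ t ≤ Ls.card ∧ ∀ l ∈ Ls,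
      ∀ i ∈ Ks, ∀ j ∈ Ks, ∀ k ∈ Ks, i ≠ j → i ≠ k → j ≠ k → A.Few μ (fun k => Q k l) i j k := by
  obtain ⟨n, hn⟩ := exists_nat_ge ((2 : ℝ) / μ)
  obtain ⟨s1, hs1⟩ := commonPt 3 d hd (n + 3)
  obtain ⟨s, hs⟩ := everywhere 3 1 t s1
  refine ⟨s, fun A K L hA hA5 hKI hLI hKL hKc hLc Q hQ => ?_⟩
  have dj : ∀ x ∈ K, ∀ y ∈ L, x ≠ y := fun x hx y hy h => Finset.disjoint_left.mp hKL hx (h ▸ hy)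
  obtain ⟨Ks, Ls, hKs, hLs, hKsc, hLsc, hp⟩ := hs K L hKc hLc
    (fun X Y => ∃ i ∈ X, ∃ j ∈ X, ∃ k ∈ X, i < j ∧ j < k ∧ ∃ l ∈ Y, A.Few μ (fun k => Q k l) i j k) (by
    intro K' hK' L' hL' hKn hLn
    by_contra hcon
    have hmany : ∀ i ∈ K', ∀ j ∈ K', ∀ k ∈ K', i < j → j < k → ∀ l ∈ L',
        ¬ A.Few μ (fun k => Q k l) i j k := by
      intro i hi j hj k hk hij hjk l hl hf
      refine hcon ⟨{i, j, k}, by simp [Finset.insert_subset_iff, hi, hj, hk], {l}, by simpa, ?_, by simp,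
        i, by simp, j, by simp, k, by simp, hij, hjk, l, by simp, hf⟩
      exact Finset.card_eq_three.mpr ⟨i, j, k, hij.ne, (hij.trans hjk).ne, hjk.ne, rfl⟩
    obtain ⟨K2, L2, hK2, hL2, hK2c, hL2c, h2⟩ := hs1 K' L' hKn hLn
      (fun k l l' => A.nbhd l l' (Q k l) (Q k l')) (fun l l' => A.P l l')
      (fun l hl l' hl' hll => ⟨A.Pnonempty _ _ (hLI (hL' hl)) (hLI (hL' hl')) hll.ne, fun k hk =>
        ⟨A.nbhd_sub _ _ _ _, hA k l l' (hKI (hK' hk)) (hLI (hL' hl)) (hLI (hL' hl'))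
          (dj _ (hK' hk) _ (hL' hl)) (dj _ (hK' hk) _ (hL' hl')) hll.ne _ (hQ _ (hK' hk) _ (hL' hl))
          _ (hQ _ (hK' hk) _ (hL' hl'))⟩⟩)
    obtain ⟨i, hi, j, hj, k, hk, hij, hjk⟩ := three_of_card (K := K2) (by omega)
    have hik := hij.trans hjk
    have ei := hK' (hK2 hi)
    have ej := hK' (hK2 hj)
    have ek := hK' (hK2 hk)
    obtain ⟨Y, hY, hYc, ⟨u, v, w⟩, huvw, hF⟩ := pigeon 2 μ (A.P i j ×ˢ A.P i k ×ˢ A.P j k)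
      ((A.Pnonempty _ _ (hKI ei) (hKI ej) hij.ne).product
        ((A.Pnonempty _ _ (hKI ei) (hKI ek) hik.ne).product (A.Pnonempty _ _ (hKI ej) (hKI ek) hjk.ne)))
      L2 (fun l => ((A.nbhd i j (Q i l) (Q j l)) ×ˢ (A.nbhd i k (Q i l) (Q k l)) ×ˢ
        (A.nbhd j k (Q j l) (Q k l))).filter fun t => A.Edge t.1 t.2.1 t.2.2)
      (fun l hl => (Finset.filter_subset _ _).trans (Finset.product_subset_product (A.nbhd_sub _ _ _ _)
        (Finset.product_subset_product (A.nbhd_sub _ _ _ _) (A.nbhd_sub _ _ _ _))))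
      (fun l hl => by
        have := hmany i (hK2 hi) j (hK2 hj) k (hK2 hk) hij hjk l (hL2 hl)
        unfold Few ecount at this
        push Not at this
        simp only [Finset.card_product, Nat.cast_mul]
        rw [← mul_assoc (_ : ℝ) (_ : ℝ) (((A.P j k).card : ℝ))]
        exact this.le) (by
        rw [div_le_iff₀ hμ] at hn
        have : (n : ℝ) ≤ L2.card := by exact_mod_cast (by omega : n ≤ L2.card)
        push_cast
        nlinarith)
    obtain ⟨l, hl, l', hl', hll⟩ := two_of_card (K := Y) (by omega)
    obtain ⟨z, hz, hzF⟩ := h2 {i, j, k} (by simp [Finset.insert_subset_iff, hi, hj, hk])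
      (Finset.card_eq_three.mpr ⟨i, j, k, hij.ne, (hij.trans hjk).ne, hjk.ne, rfl⟩)
      l (hY hl) l' (hY hl') hll
    have el := hL' (hL2 (hY hl))
    have el' := hL' (hL2 (hY hl'))
    have f1 := hF l hl
    have f2 := hF l' hl'
    have z1 := hzF i (by simp)
    have z2 := hzF j (by simp)
    have z3 := hzF k (by simp)
    simp only [Finset.mem_filter, Finset.mem_product, mem_nbhd] at f1 f2 z1 z2 z3 huvw
    refine hA5 (k5_mk A i j k l l' (hKI ei) (hKI ej) (hKI ek) (hLI el) (hLI el') ?_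
      u v (Q i l) (Q i l') w (Q j l) (Q j l') (Q k l) (Q k l') z
      huvw.1 huvw.2.1 (hQ _ ei _ el) (hQ _ ei _ el') huvw.2.2 (hQ _ ej _ el) (hQ _ ej _ el')
      (hQ _ ek _ el) (hQ _ ek _ el') hz
      f1.2 (A.rot (A.rot f1.1.1.2)) (A.rot (A.rot f2.1.1.2)) (A.rot (A.rot f1.1.2.1.2))
      (A.rot (A.rot f2.1.2.1.2)) z1.2 (A.rot (A.rot f1.1.2.2.2)) (A.rot (A.rot f2.1.2.2.2)) z2.2 z3.2)
    simp [hij.ne, hik.ne, hjk.ne, hll.ne, dj i ei l el, dj i ei l' el', dj j ej l el, dj j ej l' el',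
      dj k ek l el, dj k ek l' el'])
  refine ⟨Ks, Ls, hKs, hLs, hKsc, hLsc, fun l hl => few_all A μ _ Ks ?_⟩
  intro i hi j hj k hk hij hjk
  obtain ⟨i', hi', j', hj', k', hk', hij', hjk', l', hl', hf⟩ :=
    hp {i, j, k} (by simp [Finset.insert_subset_iff, hi, hj, hk]) {l} (by simpa)
    (Finset.card_eq_three.mpr ⟨i, j, k, hij.ne, (hij.trans hjk).ne, hjk.ne, rfl⟩) (by simp)
  simp only [Finset.mem_insert, Finset.mem_singleton] at hi' hj' hk' hl'
  have e1 : i' = i := by omega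
  have e2 : j' = j := by omega
  have e3 : k' = k := by omega
  subst e1 e2 e3 hl'
  exact hf

theorem link_inter (A : ReducedHG) (K : Finset ℕ) (f : ℕ → ℕ) (i j : ℕ) (hi : i ∈ K) (hj : j ∈ K)
    (hij : i ≠ j) : A.link K f ∩ A.P i j = A.nbhd i j (f i) (f j) := by
  ext c
  simp only [link, Finset.mem_inter, Finset.mem_biUnion, Finset.mem_filter, Finset.mem_product]
  constructor
  · rintro ⟨⟨⟨a, b⟩, ⟨⟨ha, hb⟩, hab⟩, hc⟩, hcP⟩
    simp only at ha hb hab hc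
    by_cases h : ({a, b} : Finset ℕ) = {i, j}
    · have h1 : a ∈ ({i, j} : Finset ℕ) := h ▸ (by simp)
      have h2 : b ∈ ({i, j} : Finset ℕ) := h ▸ (by simp)
      simp only [Finset.mem_insert, Finset.mem_singleton] at h1 h2
      rcases h1 with rfl | rfl <;> rcases h2 with rfl | rfl
      · exact absurd rfl hab
      · exact hc
      · rw [nbhd_symm]; exact hc
      · exact absurd rfl hab
    · exact absurd hcP (Finset.disjoint_left.mp (A.Pdisjoint a b i j hab hij h) (A.nbhd_sub _ _ _ _ hc))
  · intro h
    exact ⟨⟨(i, j), ⟨⟨hi, hj⟩, hij⟩, h⟩, A.nbhd_sub _ _ _ _ h⟩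

theorem hole_of_few (A : ReducedHG) (μ d : ℝ) (hd : 0 < d) (hA : A.EEDense d) (K : Finset ℕ)
    (f : ℕ → ℕ) (l : ℕ) (hK : K ⊆ A.I) (hl : l ∈ A.I) (hlK : l ∉ K) (hf : ∀ k ∈ K, f k ∈ A.P k l)
    (h : ∀ i ∈ K, ∀ j ∈ K, ∀ k ∈ K, i ≠ j → i ≠ k → j ≠ k → A.Few μ f i j k) :
    A.IsHoleW μ d K (A.link K f) := by
  have hw : ∀ i ∈ K, ∀ j ∈ K, i ≠ j →
      d * ((A.P i j).card : ℝ) ≤ (((A.link K f ∩ A.P i j)).card : ℝ) := by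
    intro i hi j hj hij
    rw [link_inter A K f i j hi hj hij]
    exact hA l i j hl (hK hi) (hK hj) (fun h => hlK (h ▸ hi)) (fun h => hlK (h ▸ hj)) hij _
      (A.Psymm i l ▸ hf i hi) _ (A.Psymm j l ▸ hf j hj)
  refine ⟨⟨?_, ?_⟩, hw⟩
  · intro i hi j hj hij
    have h1 := hw i hi j hj hij
    have h2 : (0 : ℝ) < (A.P i j).card := by
      exact_mod_cast (A.Pnonempty i j (hK hi) (hK hj) hij).card_pos
    have h3 : (0 : ℝ) < ((A.link K f ∩ A.P i j).card : ℝ) := lt_of_lt_of_le (mul_pos hd h2) h1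
    exact Finset.card_pos.mp (by exact_mod_cast h3)
  · intro i hi j hj k hk hij hik hjk
    rw [link_inter A K f i j hi hj hij, link_inter A K f i k hi hk hik, link_inter A K f j k hj hk hjk]
    exact h i hi j hj k hk hij hik hjk

end ReducedHG

namespace ReducedHG

theorem intdisj (t : ℕ) (δ : ℝ) : ∃ s : ℕ, ∀ (A : ReducedHG) (K L M : Finset ℕ),
    s ≤ K.card → s ≤ L.card → s ≤ M.card → ∀ T U : ℕ → ℕ → ℕ,
    ∃ Ks Ls Ms : Finset ℕ, Ks ⊆ K ∧ Ls ⊆ L ∧ Ms ⊆ M ∧ t ≤ Ks.card ∧ t ≤ Ls.card ∧ t ≤ Ms.card ∧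
      (A.IntersectingLinks δ Ks Ls Ms T U ∨ A.DisjointLinks δ Ks Ls Ms T U) := by
  obtain ⟨s, hs⟩ := colour4 t
  refine ⟨s, fun A K L M hK hL hM T U => ?_⟩
  obtain ⟨Ks, Ls, Ms, hKs, hLs, hMs, hKc, hLc, hMc, h⟩ := hs K L M hK hL hM
    (fun a a' b c => δ * ((A.P a a').card : ℝ) ≤
      (((A.nbhd a a' (T a b) (T a' b)) ∩ (A.nbhd a a' (U a c) (U a' c))).card : ℝ))
  refine ⟨Ks, Ls, Ms, hKs, hLs, hMs, hKc, hLc, hMc, ?_⟩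
  rcases h with h | h
  · left
    intro a ha a' ha' haa b hb c hc
    rcases lt_or_gt_of_ne haa with h' | h'
    · exact h a ha a' ha' h' b hb c hc
    · rw [A.Psymm, A.nbhd_symm a a' (T a b), A.nbhd_symm a a' (U a c)]
      exact h a' ha' a ha h' b hb c hc
  · right
    intro a ha a' ha' haa b hb c hc
    rcases lt_or_gt_of_ne haa with h' | h'
    · exact not_le.mp (h a ha a' ha' h' b hb c hc)
    · rw [A.Psymm, A.nbhd_symm a a' (T a b), A.nbhd_symm a a' (U a c)]
      exact not_le.mp (h a' ha' a ha h' b hb c hc)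

def Valid (d : ℝ) (A : ReducedHG) (Q R S : ℕ → ℕ → ℕ) (K L M : Finset ℕ) : Prop :=
  A.EEDense d ∧ ¬ A.SupportsK5 ∧ K ⊆ A.I ∧ L ⊆ A.I ∧ M ⊆ A.I ∧ Disjoint K L ∧ Disjoint K M ∧
    Disjoint L M ∧ A.IsTransversal2 K L Q ∧ A.IsTransversal2 K M R ∧ A.IsTransversal2 L M S ∧
    A.InhabitedTriple2 K L M Q R S

abbrev CProp := ReducedHG → (ℕ → ℕ → ℕ) → (ℕ → ℕ → ℕ) → (ℕ → ℕ → ℕ) → Finset ℕ → Finset ℕ →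
  Finset ℕ → Prop

def Her (pp : CProp) : Prop := ∀ A Q R S K L M Ks Ls Ms, Ks ⊆ K → Ls ⊆ L → Ms ⊆ M →
  pp A Q R S K L M → pp A Q R S Ks Ls Ms

def Ach (d : ℝ) (pp : CProp) : Prop := ∀ t : ℕ, ∃ s : ℕ, ∀ A Q R S K L M, Valid d A Q R S K L M →
  s ≤ K.card → s ≤ L.card → s ≤ M.card → ∃ Ks Ls Ms : Finset ℕ, Ks ⊆ K ∧ Ls ⊆ L ∧ Ms ⊆ M ∧
    t ≤ Ks.card ∧ t ≤ Ls.card ∧ t ≤ Ms.card ∧ pp A Q R S Ks Ls Ms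

theorem her_valid (d : ℝ) : Her (Valid d) := by
  rintro A Q R S K L M Ks Ls Ms hK hL hM ⟨h1, h2, h3, h4, h5, h6, h7, h8, h9, h10, h11, h12⟩
  exact ⟨h1, h2, hK.trans h3, hL.trans h4, hM.trans h5, Finset.disjoint_of_subset_left hK
    (Finset.disjoint_of_subset_right hL h6), Finset.disjoint_of_subset_left hK
    (Finset.disjoint_of_subset_right hM h7), Finset.disjoint_of_subset_left hL
    (Finset.disjoint_of_subset_right hM h8), fun k hk l hl => h9 k (hK hk) l (hL hl),
    fun k hk l hl => h10 k (hK hk) l (hM hl), fun k hk l hl => h11 k (hL hk) l (hM hl),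
    fun k hk l hl m hm => h12 k (hK hk) l (hL hl) m (hM hm)⟩

def And2 (pp₁ pp₂ : CProp) : CProp := fun A Q R S K L M => pp₁ A Q R S K L M ∧ pp₂ A Q R S K L M

theorem her_and {pp₁ pp₂ : CProp} (h1 : Her pp₁) (h2 : Her pp₂) : Her (And2 pp₁ pp₂) :=
  fun A Q R S K L M Ks Ls Ms hK hL hM h => ⟨h1 A Q R S K L M Ks Ls Ms hK hL hM h.1,
    h2 A Q R S K L M Ks Ls Ms hK hL hM h.2⟩

theorem ach_and {d : ℝ} {pp₁ pp₂ : CProp} (h : Her pp₁) (h1 : Ach d pp₁) (h2 : Ach d pp₂) :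
    Ach d (And2 pp₁ pp₂) := by
  intro t
  obtain ⟨s2, hs2⟩ := h2 t
  obtain ⟨s1, hs1⟩ := h1 s2
  refine ⟨s1, fun A Q R S K L M hV hK hL hM => ?_⟩
  obtain ⟨K1, L1, M1, hK1, hL1, hM1, cK1, cL1, cM1, p1⟩ := hs1 A Q R S K L M hV hK hL hM
  obtain ⟨K2, L2, M2, hK2, hL2, hM2, cK2, cL2, cM2, p2⟩ := hs2 A Q R S K1 L1 M1
    (her_valid d A Q R S K L M K1 L1 M1 hK1 hL1 hM1 hV) cK1 cL1 cM1
  exact ⟨K2, L2, M2, hK2.trans hK1, hL2.trans hL1, hM2.trans hM1, cK2, cL2, cM2,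
    h A Q R S K1 L1 M1 K2 L2 M2 hK2 hL2 hM2 p1, p2⟩

def IoD (A : ReducedHG) (δ : ℝ) (K L M : Finset ℕ) (T U : ℕ → ℕ → ℕ) : Prop :=
  A.IntersectingLinks δ K L M T U ∨ A.DisjointLinks δ K L M T U

theorem IoD.mono {A : ReducedHG} {δ : ℝ} {K L M Ks Ls Ms : Finset ℕ} {T U : ℕ → ℕ → ℕ}
    (h : A.IoD δ K L M T U) (hK : Ks ⊆ K) (hL : Ls ⊆ L) (hM : Ms ⊆ M) : A.IoD δ Ks Ls Ms T U := by
  rcases h with h | h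
  · exact Or.inl fun a ha a' ha' haa b hb c hc => h a (hK ha) a' (hK ha') haa b (hL hb) c (hM hc)
  · exact Or.inr fun a ha a' ha' haa b hb c hc => h a (hK ha) a' (hK ha') haa b (hL hb) c (hM hc)

def Hol (A : ReducedHG) (μ : ℝ) (K L : Finset ℕ) (Q : ℕ → ℕ → ℕ) : Prop := ∀ l ∈ L,
  ∀ i ∈ K, ∀ j ∈ K, ∀ k ∈ K, i ≠ j → i ≠ k → j ≠ k → A.Few μ (fun k => Q k l) i j k

theorem Hol.mono {A : ReducedHG} {μ : ℝ} {K L Ks Ls : Finset ℕ} {Q : ℕ → ℕ → ℕ}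
    (h : A.Hol μ K L Q) (hK : Ks ⊆ K) (hL : Ls ⊆ L) : A.Hol μ Ks Ls Q :=
  fun l hl i hi j hj k hk => h l (hL hl) i (hK hi) j (hK hj) k (hK hk)

def p1 (δ : ℝ) : CProp := fun A Q R _ K L M => A.IoD δ K L M Q R
def p2 (δ : ℝ) : CProp := fun A Q _ S K L M => A.IoD δ L K M (fun l k => Q k l) S
def p3 (δ : ℝ) : CProp := fun A _ R S K L M => A.IoD δ M K L (fun m k => R k m) (fun m l => S l m)
def p4 (μ : ℝ) : CProp := fun A Q _ _ K L _ => A.Hol μ K L Q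
def p5 (μ : ℝ) : CProp := fun A Q _ _ K L _ => A.Hol μ L K (fun l k => Q k l)
def p6 (μ : ℝ) : CProp := fun A _ R _ K _ M => A.Hol μ K M R
def p7 (μ : ℝ) : CProp := fun A _ R _ K _ M => A.Hol μ M K (fun m k => R k m)
def p8 (μ : ℝ) : CProp := fun A _ _ S _ L M => A.Hol μ L M S
def p9 (μ : ℝ) : CProp := fun A _ _ S _ L M => A.Hol μ M L (fun m l => S l m)

theorem ach_all (δ μ d : ℝ) (hμ : 0 < μ) (hd : 0 < d) :
    Ach d (And2 (p1 δ) (And2 (p2 δ) (And2 (p3 δ) (And2 (p4 μ) (And2 (p5 μ) (And2 (p6 μ)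
      (And2 (p7 μ) (And2 (p8 μ) (p9 μ))))))))) := by
  refine ach_and (fun A Q R S K L M Ks Ls Ms hK hL hM h => IoD.mono h hK hL hM) ?_ <|
    ach_and (fun A Q R S K L M Ks Ls Ms hK hL hM h => IoD.mono h hL hK hM) ?_ <|
    ach_and (fun A Q R S K L M Ks Ls Ms hK hL hM h => IoD.mono h hM hK hL) ?_ <|
    ach_and (fun A Q R S K L M Ks Ls Ms hK hL hM h => Hol.mono h hK hL) ?_ <|
    ach_and (fun A Q R S K L M Ks Ls Ms hK hL hM h => Hol.mono h hL hK) ?_ <|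
    ach_and (fun A Q R S K L M Ks Ls Ms hK hL hM h => Hol.mono h hK hM) ?_ <|
    ach_and (fun A Q R S K L M Ks Ls Ms hK hL hM h => Hol.mono h hM hK) ?_ <|
    ach_and (fun A Q R S K L M Ks Ls Ms hK hL hM h => Hol.mono h hL hM) ?_ ?_
  · intro t
    obtain ⟨s, hs⟩ := intdisj t δ
    refine ⟨s, fun A Q R S K L M hV cK cL cM => ?_⟩
    obtain ⟨X, Y, Z, hX, hY, hZ, cX, cY, cZ, h⟩ := hs A K L M cK cL cM Q R
    exact ⟨X, Y, Z, hX, hY, hZ, cX, cY, cZ, h⟩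
  · intro t
    obtain ⟨s, hs⟩ := intdisj t δ
    refine ⟨s, fun A Q R S K L M hV cK cL cM => ?_⟩
    obtain ⟨X, Y, Z, hX, hY, hZ, cX, cY, cZ, h⟩ := hs A L K M cL cK cM (fun l k => Q k l) S
    exact ⟨Y, X, Z, hY, hX, hZ, cY, cX, cZ, h⟩
  · intro t
    obtain ⟨s, hs⟩ := intdisj t δ
    refine ⟨s, fun A Q R S K L M hV cK cL cM => ?_⟩
    obtain ⟨X, Y, Z, hX, hY, hZ, cX, cY, cZ, h⟩ := hs A M K L cM cK cL (fun m k => R k m) (fun m l => S l m)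
    exact ⟨Y, Z, X, hY, hZ, hX, cY, cZ, cX, h⟩
  all_goals
    intro t
    obtain ⟨s, hs⟩ := holes t μ d hμ hd
    refine ⟨max s t, ?_⟩
    rintro A Q R S K L M ⟨h1, h2, h3, h4, h5, h6, h7, h8, h9, h10, h11, h12⟩ cK cL cM
  · obtain ⟨X, Y, hX, hY, cX, cY, h⟩ := hs A K L h1 h2 h3 h4 h6 (by omega) (by omega) Q h9
    exact ⟨X, Y, M, hX, hY, subset_rfl, cX, cY, by omega, h⟩
  · obtain ⟨X, Y, hX, hY, cX, cY, h⟩ := hs A L K h1 h2 h4 h3 h6.symm (by omega) (by omega)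
      (fun l k => Q k l) (fun l hl k hk => A.Psymm k l ▸ h9 k hk l hl)
    exact ⟨Y, X, M, hY, hX, subset_rfl, cY, cX, by omega, h⟩
  · obtain ⟨X, Y, hX, hY, cX, cY, h⟩ := hs A K M h1 h2 h3 h5 h7 (by omega) (by omega) R h10
    exact ⟨X, L, Y, hX, subset_rfl, hY, cX, by omega, cY, h⟩
  · obtain ⟨X, Y, hX, hY, cX, cY, h⟩ := hs A M K h1 h2 h5 h3 h7.symm (by omega) (by omega)
      (fun l k => R k l) (fun l hl k hk => A.Psymm k l ▸ h10 k hk l hl)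
    exact ⟨Y, L, X, hY, subset_rfl, hX, cY, by omega, cX, h⟩
  · obtain ⟨X, Y, hX, hY, cX, cY, h⟩ := hs A L M h1 h2 h4 h5 h8 (by omega) (by omega) S h11
    exact ⟨K, X, Y, subset_rfl, hX, hY, by omega, cX, cY, h⟩
  · obtain ⟨X, Y, hX, hY, cX, cY, h⟩ := hs A M L h1 h2 h5 h4 h8.symm (by omega) (by omega)
      (fun l k => S k l) (fun l hl k hk => A.Psymm k l ▸ h11 k hk l hl)
    exact ⟨K, Y, X, subset_rfl, hY, hX, by omega, cY, cX, h⟩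

end ReducedHG


/-- Corollary (`cor:cleaning`): after restricting an inhabited triple of transversals in a
`(d, ee)`-dense reduced hypergraph not supporting a `K₅⁽³⁾` to suitable subsets of size `t`,
at most one pair of its restricted transversals has `δ`-intersecting links, the other pairs
have `δ`-disjoint links, and all relevant links are `(μ, d)`-holes. -/
theorem cleaning :
    ∀ (t : ℕ) (δ μ d : ℝ), 0 < δ → 0 < μ → 0 < d → ∃ s : ℕ,
      ∀ (A : ReducedHG), A.EEDense d → ¬ A.SupportsK5 →
        ∀ K L M : Finset ℕ,
          K ⊆ A.I → L ⊆ A.I → M ⊆ A.I →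
          Disjoint K L → Disjoint K M → Disjoint L M →
          s ≤ K.card → s ≤ L.card → s ≤ M.card →
          ∀ Q R S : ℕ → ℕ → ℕ,
            A.IsTransversal2 K L Q → A.IsTransversal2 K M R → A.IsTransversal2 L M S →
            A.InhabitedTriple2 K L M Q R S →
            ∃ Ks Ls Ms : Finset ℕ, Ks ⊆ K ∧ Ls ⊆ L ∧ Ms ⊆ M ∧
              t ≤ Ks.card ∧ t ≤ Ls.card ∧ t ≤ Ms.card ∧
              -- (i) every pair has δ-intersecting or δ-disjoint links, and at most one pair
              -- has δ-intersecting links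
              ((A.IntersectingLinks δ Ks Ls Ms Q R ∨ A.DisjointLinks δ Ks Ls Ms Q R) ∧
               (A.IntersectingLinks δ Ls Ks Ms (fun l k => Q k l) S ∨
                  A.DisjointLinks δ Ls Ks Ms (fun l k => Q k l) S) ∧
               (A.IntersectingLinks δ Ms Ks Ls (fun m k => R k m) (fun m l => S l m) ∨
                  A.DisjointLinks δ Ms Ks Ls (fun m k => R k m) (fun m l => S l m)) ∧
               (A.IntersectingLinks δ Ks Ls Ms Q R →
                  A.DisjointLinks δ Ls Ks Ms (fun l k => Q k l) S ∧
                  A.DisjointLinks δ Ms Ks Ls (fun m k => R k m) (fun m l => S l m)) ∧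
               (A.IntersectingLinks δ Ls Ks Ms (fun l k => Q k l) S →
                  A.DisjointLinks δ Ks Ls Ms Q R ∧
                  A.DisjointLinks δ Ms Ks Ls (fun m k => R k m) (fun m l => S l m)) ∧
               (A.IntersectingLinks δ Ms Ks Ls (fun m k => R k m) (fun m l => S l m) →
                  A.DisjointLinks δ Ks Ls Ms Q R ∧
                  A.DisjointLinks δ Ls Ks Ms (fun l k => Q k l) S)) ∧
              -- (ii) all the links are (μ, d)-holes
              (∀ k ∈ Ks, ∀ l ∈ Ls, ∀ m ∈ Ms,
                A.IsHoleW μ d Ks (A.link Ks (fun k' => Q k' l)) ∧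
                A.IsHoleW μ d Ls (A.link Ls (fun l' => Q k l')) ∧
                A.IsHoleW μ d Ks (A.link Ks (fun k' => R k' m)) ∧
                A.IsHoleW μ d Ms (A.link Ms (fun m' => R k m')) ∧
                A.IsHoleW μ d Ls (A.link Ls (fun l' => S l' m)) ∧
                A.IsHoleW μ d Ms (A.link Ms (fun m' => S l m'))) := by

  intro t δ μ d hδ hμ hd
  obtain ⟨s0, hs0⟩ := ReducedHG.cross δ hδ
  obtain ⟨s, hs⟩ := ReducedHG.ach_all δ μ d hμ hd (max t (max s0 1))
  refine ⟨s, fun A hA hA5 K L M hKI hLI hMI hKL hKM hLM cK cL cM Q R S hQ hR hS hE => ?_⟩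
  have hV : ReducedHG.Valid d A Q R S K L M :=
    ⟨hA, hA5, hKI, hLI, hMI, hKL, hKM, hLM, hQ, hR, hS, hE⟩
  obtain ⟨Ks, Ls, Ms, hKs, hLs, hMs, cKs, cLs, cMs, q1, q2, q3, q4, q5, q6, q7, q8, q9⟩ :=
    hs A Q R S K L M hV cK cL cM
  obtain ⟨-, -, hKI, hLI, hMI, hKL, hKM, hLM, hQ, hR, hS, hE⟩ :=
    ReducedHG.her_valid d A Q R S K L M Ks Ls Ms hKs hLs hMs hV
  have dKL : ∀ x ∈ Ks, x ∉ Ls := fun x hx => Finset.disjoint_left.mp hKL hx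
  have dKM : ∀ x ∈ Ks, x ∉ Ms := fun x hx => Finset.disjoint_left.mp hKM hx
  have dLM : ∀ x ∈ Ls, x ∉ Ms := fun x hx => Finset.disjoint_left.mp hLM hx
  obtain ⟨k0, hk0⟩ : Ks.Nonempty := Finset.card_pos.mp (by omega)
  obtain ⟨l0, hl0⟩ : Ls.Nonempty := Finset.card_pos.mp (by omega)
  obtain ⟨m0, hm0⟩ : Ms.Nonempty := Finset.card_pos.mp (by omega)
  have c12 : ¬ (A.IntersectingLinks δ Ks Ls Ms Q R ∧
      A.IntersectingLinks δ Ls Ks Ms (fun l k => Q k l) S) := by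
    rintro ⟨a, b⟩
    exact hA5 (hs0 A Ks Ls m0 hKI hLI (hMI hm0) hKL (fun h => dKM _ h hm0) (fun h => dLM _ h hm0)
      (by omega) (by omega) Q (fun k => R k m0) (fun l => S l m0) hQ (fun k hk => hR k hk _ hm0)
      (fun l hl => hS l hl _ hm0) (fun k hk l hl => hE k hk l hl _ hm0)
      (fun k hk k' hk' hkk l hl => a k hk k' hk' hkk l hl m0 hm0)
      (fun k hk k' hk' hkk l hl => b k hk k' hk' hkk l hl m0 hm0))
  have c13 : ¬ (A.IntersectingLinks δ Ks Ls Ms Q R ∧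
      A.IntersectingLinks δ Ms Ks Ls (fun m k => R k m) (fun m l => S l m)) := by
    rintro ⟨a, b⟩
    exact hA5 (hs0 A Ks Ms l0 hKI hMI (hLI hl0) hKM (fun h => dKL _ h hl0) (dLM _ hl0)
      (by omega) (by omega) R (fun k => Q k l0) (fun m => S l0 m) hR (fun k hk => hQ k hk _ hl0)
      (fun m hm => A.Psymm l0 m ▸ hS _ hl0 m hm)
      (fun k hk m hm => A.EdgeSymm _ _ _ (hE k hk _ hl0 m hm))
      (fun k hk k' hk' hkk m hm => by
        rw [Finset.inter_comm]; exact a k hk k' hk' hkk l0 hl0 m hm)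
      (fun k hk k' hk' hkk l hl => b k hk k' hk' hkk l hl l0 hl0))
  have c23 : ¬ (A.IntersectingLinks δ Ls Ks Ms (fun l k => Q k l) S ∧
      A.IntersectingLinks δ Ms Ks Ls (fun m k => R k m) (fun m l => S l m)) := by
    rintro ⟨a, b⟩
    exact hA5 (hs0 A Ls Ms k0 hLI hMI (hKI hk0) hLM (dKL _ hk0) (dKM _ hk0)
      (by omega) (by omega) S (fun l => Q k0 l) (fun m => R k0 m) hS
      (fun l hl => A.Psymm k0 l ▸ hQ _ hk0 l hl)
      (fun m hm => A.Psymm k0 m ▸ hR _ hk0 m hm)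
      (fun l hl m hm => A.rot (A.rot (hE _ hk0 l hl m hm)))
      (fun l hl l' hl' hll m hm => by
        rw [Finset.inter_comm]; exact a l hl l' hl' hll k0 hk0 m hm)
      (fun m hm m' hm' hmm l hl => by
        rw [Finset.inter_comm]; exact b m hm m' hm' hmm k0 hk0 l hl))
  refine ⟨Ks, Ls, Ms, hKs, hLs, hMs, by omega, by omega, by omega, ⟨q1, q2, q3, ?_, ?_, ?_⟩, ?_⟩
  · exact fun h => ⟨q2.resolve_left fun h' => c12 ⟨h, h'⟩, q3.resolve_left fun h' => c13 ⟨h, h'⟩⟩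
  · exact fun h => ⟨q1.resolve_left fun h' => c12 ⟨h', h⟩, q3.resolve_left fun h' => c23 ⟨h, h'⟩⟩
  · exact fun h => ⟨q1.resolve_left fun h' => c13 ⟨h', h⟩, q2.resolve_left fun h' => c23 ⟨h', h⟩⟩
  · intro k hk l hl m hm
    refine ⟨?_, ?_, ?_, ?_, ?_, ?_⟩
    · exact A.hole_of_few μ d hd hA Ks _ l hKI (hLI hl) (fun h => dKL _ h hl)
        (fun x hx => hQ x hx l hl) (q4 l hl)
    · exact A.hole_of_few μ d hd hA Ls _ k hLI (hKI hk) (dKL _ hk)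
        (fun x hx => A.Psymm k x ▸ hQ k hk x hx) (q5 k hk)
    · exact A.hole_of_few μ d hd hA Ks _ m hKI (hMI hm) (fun h => dKM _ h hm)
        (fun x hx => hR x hx m hm) (q6 m hm)
    · exact A.hole_of_few μ d hd hA Ms _ k hMI (hKI hk) (dKM _ hk)
        (fun x hx => A.Psymm k x ▸ hR k hk x hx) (q7 k hk)
    · exact A.hole_of_few μ d hd hA Ls _ m hLI (hMI hm) (fun h => dLM _ h hm)
        (fun x hx => hS x hx m hm) (q8 m hm)
    · exact A.hole_of_few μ d hd hA Ms _ l hMI (hLI hl) (dLM _ hl)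
        (fun x hx => A.Psymm l x ▸ hS l hl x hx) (q9 l hl)
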